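/- For every even integer $t \ge 2$, $\limsup_{n \to \infty} \frac{ex(n,n,n,K_{2,t})}{n^{3/2}} \le \frac{3\sqrt{t-1}}{\sqrt{2}}$. -/

import Mathlib

/-- `exTri t n` is `ex(n,n,n,K_{2,t})`: the maximum number of edges in a 3-partite graph
with three parts each of size `n` (vertex `u` lies in part `u.1`) containing no copy of
`K_{2,t}`, i.e. in which every two distinct vertices have at most `t-1` common
neighbours. -/
noncomputable def exTri (t n : ℕ) : ℕ :=
  sSup {m | ∃ G : SimpleGraph (Fin 3 × Fin n),
    (∀ u v, G.Adj u v → u.1 ≠ v.1) ∧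
    (∀ u v, u ≠ v → (G.commonNeighbors u v).ncard ≤ t - 1) ∧
    G.edgeSet.ncard = m}

open Classical in
/-- The sum of all entries of the adjacency matrix is twice the number of edges. -/
theorem SimpleGraph.sum_sum_adj_eq_twice_ncard_edgeSet {V : Type*} [Fintype V]
    (G : SimpleGraph V) :
    ∑ v, ∑ u, (if G.Adj v u then (1 : ℝ) else 0) = 2 * (G.edgeSet.ncard : ℝ) := by
  have hdeg : ∀ v, ∑ u, (if G.Adj v u then (1 : ℝ) else 0) = G.degree v := by
    intro v
    rw [Finset.sum_boole, ← G.card_neighborFinset_eq_degree, G.neighborFinset_eq_filter]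
  simp_rw [hdeg]
  have h := G.sum_degrees_eq_twice_card_edges
  rw [← G.coe_edgeFinset, Set.ncard_coe_finset]
  exact_mod_cast h

open Classical in
/-- Double counting of the paths of length two whose endpoints lie in a common part, combined
with the Cauchy–Schwarz inequality. -/
theorem SimpleGraph.sq_two_mul_ncard_edgeSet_le {s n : ℕ} (G : SimpleGraph (Fin 3 × Fin n))
    (hpart : ∀ u v, G.Adj u v → u.1 ≠ v.1)
    (hcommon : ∀ u v, u ≠ v → (G.commonNeighbors u v).ncard ≤ s) :
    (2 * (G.edgeSet.ncard : ℝ)) ^ 2 ≤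
      6 * n * (2 * (G.edgeSet.ncard : ℝ) + 3 * s * n ^ 2) := by
  set a : Fin 3 × Fin n → Fin 3 × Fin n → ℝ := fun v u => if G.Adj v u then 1 else 0 with ha
  set d : Fin 3 × Fin n → Fin 3 → ℝ := fun v j => ∑ x, a v (j, x) with hd
  have hsum : ∑ v, ∑ u, a v u = 2 * (G.edgeSet.ncard : ℝ) :=
    G.sum_sum_adj_eq_twice_ncard_edgeSet
  have hsymm : ∀ u v, a u v = a v u := fun u v => by simp only [ha, G.adj_comm]
  have hzero : ∀ v, d v v.1 = 0 := fun v =>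
    Finset.sum_eq_zero fun x _ => if_neg fun h => hpart v (v.1, x) h rfl
  have hrow : ∀ v, (∑ u, a v u) ^ 2 ≤ 2 * ∑ j, d v j ^ 2 := by
    intro v
    have h0 := hzero v
    rw [Fintype.sum_prod_type]
    change (∑ j, d v j) ^ 2 ≤ _
    rw [Fin.sum_univ_three, Fin.sum_univ_three]
    obtain ⟨i, x⟩ := v
    fin_cases i <;> simp only [Fin.zero_eta, Fin.mk_one, Fin.reduceFinMk] at h0 ⊢ <;> rw [h0]
    · nlinarith [sq_nonneg (d (0, x) 1 - d (0, x) 2)]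
    · nlinarith [sq_nonneg (d (1, x) 0 - d (1, x) 2)]
    · nlinarith [sq_nonneg (d (2, x) 0 - d (2, x) 1)]
  have hpair : ∀ j x y, ∑ v, a v (j, x) * a v (j, y) ≤
      s + if x = y then ∑ v, a (j, x) v else 0 := by
    intro j x y
    by_cases hxy : x = y
    · subst hxy
      have : ∑ v, a v (j, x) * a v (j, x) = ∑ v, a (j, x) v :=
        Finset.sum_congr rfl fun v _ => by rw [hsymm (j, x) v]; simp [ha]
      simp [this]
    · have hle := hcommon (j, x) (j, y) (by simp [hxy])
      have : ∑ v, a v (j, x) * a v (j, y) =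
          ((G.commonNeighbors (j, x) (j, y)).ncard : ℝ) := by
        have hset : G.commonNeighbors (j, x) (j, y) =
            (Finset.univ.filter fun v => G.Adj v (j, x) ∧ G.Adj v (j, y) :
              Finset (Fin 3 × Fin n)) := by
          ext v
          simp [SimpleGraph.mem_commonNeighbors, G.adj_comm]
        rw [hset, Set.ncard_coe_finset, ← Finset.sum_boole]
        refine Finset.sum_congr rfl fun v _ => ?_
        simp only [ha, ite_and, ite_mul, one_mul, zero_mul]
      rw [this, if_neg hxy, add_zero]
      exact_mod_cast hle
  have hsq : ∑ v, ∑ j, d v j ^ 2 ≤ 2 * (G.edgeSet.ncard : ℝ) + 3 * s * n ^ 2 := by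
    calc ∑ v, ∑ j, d v j ^ 2
        = ∑ j, ∑ x, ∑ y, ∑ v, a v (j, x) * a v (j, y) := by
          rw [Finset.sum_comm]
          refine Finset.sum_congr rfl fun j _ => ?_
          simp only [hd, sq, Finset.sum_mul_sum]
          rw [Finset.sum_comm]
          exact Finset.sum_congr rfl fun x _ => Finset.sum_comm
      _ ≤ ∑ j, ∑ x, ∑ y, ((s : ℝ) + if x = y then ∑ v, a (j, x) v else 0) := by
          gcongr with j _ x _ y _
          exact hpair j x y
      _ = 2 * (G.edgeSet.ncard : ℝ) + 3 * s * n ^ 2 := by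
          rw [← hsum, Fintype.sum_prod_type (f := fun v => ∑ u, a v u)]
          simp only [Finset.sum_add_distrib, Finset.sum_ite_eq, Finset.mem_univ, if_true,
            Finset.sum_const, Finset.card_univ, Fintype.card_fin, nsmul_eq_mul]
          push_cast
          ring
  have hcauchy : (∑ v, ∑ u, a v u) ^ 2 ≤ 3 * n * ∑ v, (∑ u, a v u) ^ 2 := by
    have := sq_sum_le_card_mul_sum_sq (s := Finset.univ) (f := fun v => ∑ u, a v u)
    simpa using this
  rw [← hsum]
  calc (∑ v, ∑ u, a v u) ^ 2 ≤ 3 * n * ∑ v, (∑ u, a v u) ^ 2 := hcauchy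
    _ ≤ 3 * n * ∑ v, 2 * ∑ j, d v j ^ 2 := by
        gcongr with v _
        exact hrow v
    _ = 6 * n * ∑ v, ∑ j, d v j ^ 2 := by rw [← Finset.mul_sum]; ring
    _ ≤ 6 * n * (∑ v, ∑ u, a v u + 3 * s * n ^ 2) := by
        rw [hsum]
        gcongr

/-- An explicit upper bound for `ex(n,n,n,K_{2,t})`. -/
theorem exTri_le (t n : ℕ) (ht : 1 ≤ t) :
    (exTri t n : ℝ) ≤ 3 * n + 3 * √((t : ℝ) - 1) / √2 * (n * √n) := by
  have hmem : exTri t n ∈ {m | ∃ G : SimpleGraph (Fin 3 × Fin n),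
      (∀ u v, G.Adj u v → u.1 ≠ v.1) ∧
      (∀ u v, u ≠ v → (G.commonNeighbors u v).ncard ≤ t - 1) ∧
      G.edgeSet.ncard = m} := by
    refine Nat.sSup_mem ⟨0, ⊥, by simp, fun u v _ => ?_, by simp⟩
      ⟨Nat.card (Sym2 (Fin 3 × Fin n)), ?_⟩
    · have : (⊥ : SimpleGraph (Fin 3 × Fin n)).commonNeighbors u v = ∅ := by
        ext w
        simp
      simp [this]
    · rintro m ⟨G, -, -, rfl⟩
      exact Set.ncard_le_card _
  obtain ⟨G, hpart, hcommon, hcard⟩ := hmem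
  have h := G.sq_two_mul_ncard_edgeSet_le hpart hcommon
  rw [hcard, Nat.cast_sub ht, Nat.cast_one] at h
  set e : ℝ := (exTri t n : ℝ)
  have ht' : (0 : ℝ) ≤ (t : ℝ) - 1 := by
    rw [sub_nonneg]
    exact_mod_cast ht
  have hn : (0 : ℝ) ≤ n := n.cast_nonneg
  set b : ℝ := 3 * √((t : ℝ) - 1) / √2 * (n * √n) with hb
  have hb0 : 0 ≤ b := by positivity
  have hb2 : b ^ 2 = 9 * ((t : ℝ) - 1) / 2 * n ^ 3 := by
    rw [hb, mul_pow, div_pow, mul_pow, mul_pow, Real.sq_sqrt ht', Real.sq_sqrt hn,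
      Real.sq_sqrt zero_le_two]
    ring
  have hsq : (e - 3 / 2 * n) ^ 2 ≤ (3 / 2 * n + b) ^ 2 := by
    nlinarith [mul_nonneg hn hb0]
  have := abs_le_of_sq_le_sq' hsq (by positivity)
  linarith [this.2]

/-- For every even `t ≥ 2`,
`limsup_{n→∞} ex(n,n,n,K_{2,t}) / n^{3/2} ≤ 3√(t-1)/√2`. -/
theorem stmt_13 (t : ℕ) (ht : 2 ≤ t) (hteven : Even t) :
    Filter.limsup (fun n : ℕ => (exTri t n : ℝ) / (n : ℝ) ^ (3 / 2 : ℝ))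
        Filter.atTop ≤ 3 * Real.sqrt ((t : ℝ) - 1) / Real.sqrt 2 := by
  set c : ℝ := 3 * √((t : ℝ) - 1) / √2
  have hbound : ∀ᶠ n : ℕ in Filter.atTop,
      (exTri t n : ℝ) / (n : ℝ) ^ (3 / 2 : ℝ) ≤ 3 * (√(n : ℝ))⁻¹ + c := by
    filter_upwards [Filter.eventually_gt_atTop 0] with n hn
    have hn' : (0 : ℝ) < n := by exact_mod_cast hn
    have hpow : (n : ℝ) ^ (3 / 2 : ℝ) = n * √n := by
      rw [Real.sqrt_eq_rpow, ← Real.rpow_one_add' hn'.le (by norm_num)]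
      norm_num
    have hsqrt : 0 < √(n : ℝ) := Real.sqrt_pos.2 hn'
    rw [hpow, div_le_iff₀ (by positivity)]
    refine (exTri_le t n (by omega)).trans_eq ?_
    change 3 * (n : ℝ) + c * (n * √n) = _
    field_simp
  have hlim : Filter.Tendsto (fun n : ℕ => 3 * (√(n : ℝ))⁻¹ + c) Filter.atTop (nhds c) := by
    have h := (tendsto_inv_atTop_zero.comp
      (Real.tendsto_sqrt_atTop.comp tendsto_natCast_atTop_atTop)).const_mul (3 : ℝ)
    simpa using h.add_const c
  rw [← hlim.limsup_eq]
  refine Filter.limsup_le_limsup hbound ?_ hlim.isBoundedUnder_le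
  exact Filter.IsCoboundedUnder.of_frequently_ge (a := 0)
    (Filter.Frequently.of_forall fun n => by positivity)
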